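/- Let p be a prime, k ≥ 3 and n, m positive integers, and X_1,…,X_k ⊆ F_p^n. Identify F_p^{nm} with the m-fold product F_p^n × ⋯ × F_p^n, and for each i let X_i^m ⊆ F_p^{nm} be the set of tuples (v_1,…,v_m) with v_j ∈ X_i for all j. If there exists a collection of h pairwise disjoint k-cycles in X_1×⋯×X_k, then there exists a collection of h^m pairwise disjoint k-cycles in X_1^m×⋯×X_k^m. -/

import Mathlib

open scoped Classical

/-- The set of k-cycles in X 0 x ... x X (k-1): tuples with i-th coordinate in X i
summing to zero. -/
noncomputable def cycleSet {V : Type} [AddCommGroup V] [Fintype V] (k : ℕ)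
    (X : Fin k → Finset V) : Finset (Fin k → V) :=
  (Fintype.piFinset X).filter fun x => ∑ i, x i = 0

theorem mem_cycleSet {V : Type} [AddCommGroup V] [Fintype V] {k : ℕ} {X : Fin k → Finset V}
    {x : Fin k → V} : x ∈ cycleSet k X ↔ (∀ i, x i ∈ X i) ∧ ∑ i, x i = 0 := by
  simp [cycleSet]

theorem power_disjoint_cycles (p : ℕ) [hp : Fact p.Prime] (k : ℕ) (hk : 3 ≤ k)
    (n m : ℕ) (hn : 0 < n) (hm : 0 < m) (X : Fin k → Finset (Fin n → ZMod p)) (h : ℕ)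
    (hD : ∃ D : Finset (Fin k → (Fin n → ZMod p)), D ⊆ cycleSet k X ∧
      (∀ c ∈ D, ∀ c' ∈ D, c ≠ c' → ∀ i, c i ≠ c' i) ∧ D.card = h) :
    ∃ D' : Finset (Fin k → (Fin m → Fin n → ZMod p)),
      D' ⊆ cycleSet k (fun i => Fintype.piFinset fun _ : Fin m => X i) ∧
      (∀ c ∈ D', ∀ c' ∈ D', c ≠ c' → ∀ i, c i ≠ c' i) ∧ D'.card = h ^ m := by
  obtain ⟨D, hsub, hdisj, rfl⟩ := hD
  refine ⟨(Fintype.piFinset fun _ : Fin m => D).map (Equiv.piComm _).toEmbedding, ?_, ?_, ?_⟩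
  · intro c hc
    obtain ⟨d, hd, rfl⟩ := Finset.mem_map.1 hc
    have hcycle : ∀ j, (∀ i, d j i ∈ X i) ∧ ∑ i, d j i = 0 := fun j =>
      mem_cycleSet.1 (hsub (Fintype.mem_piFinset.1 hd j))
    refine mem_cycleSet.2 ⟨fun i => Fintype.mem_piFinset.2 fun j => (hcycle j).1 i, ?_⟩
    funext j
    rw [Finset.sum_apply]
    exact (hcycle j).2
  · intro c hc c' hc' hne i hi
    obtain ⟨d, hd, rfl⟩ := Finset.mem_map.1 hc
    obtain ⟨d', hd', rfl⟩ := Finset.mem_map.1 hc'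
    refine hne (congrArg _ (funext fun j => ?_))
    by_contra hj
    exact hdisj _ (Fintype.mem_piFinset.1 hd j) _ (Fintype.mem_piFinset.1 hd' j) hj i
      (congrFun hi j)
  · simp
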